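/- Let F on U and G on V be n-linear forms (n ≥ 2) on finite-dimensional complex vector spaces that are symmetrically equivalent via linear bijections φ₁,…,φₙ : U → V with φ₁ = ⋯ = φ_t for some t < n. Then there exist linear bijections ψ₁,…,ψₙ : U → V with ψ₁ = ⋯ = ψ_t = ψ_{t+1} such that F(u₁,…,uₙ) = G(ψ_{σ(1)}u₁,…,ψ_{σ(n)}uₙ) for all u₁,…,uₙ ∈ U and every permutation σ of {1,…,n}. -/

import Mathlib

section Defs

variable {K : Type*} [Field K] {n : ℕ}

/-- The restriction of a multilinear form to a submodule. -/
def formRestrict {U : Type*} [AddCommGroup U] [Module K U]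
    (F : MultilinearMap K (fun _ : Fin n => U) K) (W : Submodule K U) :
    MultilinearMap K (fun _ : Fin n => W) K :=
  F.compLinearMap fun _ => W.subtype

/-- Two multilinear forms are congruent if a single linear bijection carries one to the other. -/
def FormCongruent {U V : Type*} [AddCommGroup U] [Module K U] [AddCommGroup V] [Module K V]
    (F : MultilinearMap K (fun _ : Fin n => U) K)
    (G : MultilinearMap K (fun _ : Fin n => V) K) : Prop :=
  ∃ φ : U ≃ₗ[K] V, ∀ u : Fin n → U, F u = G fun i => φ (u i)

/-- Symmetric equivalence of multilinear forms. -/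
def FormSymmEquiv {U V : Type*} [AddCommGroup U] [Module K U] [AddCommGroup V] [Module K V]
    (F : MultilinearMap K (fun _ : Fin n => U) K)
    (G : MultilinearMap K (fun _ : Fin n => V) K) : Prop :=
  ∃ φ : Fin n → U ≃ₗ[K] V, ∀ (σ : Equiv.Perm (Fin n)) (u : Fin n → U),
    F u = G fun i => φ (σ i) (u i)

/-- `W` is a direct-sum decomposition of the underlying space for which `F` vanishes on
mixed tuples, i.e. `F = ⨁ᵢ F|Wᵢ`. -/
def IsDecompFamily {U : Type*} [AddCommGroup U] [Module K U] {ι : Type*} [DecidableEq ι]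
    (F : MultilinearMap K (fun _ : Fin n => U) K) (W : ι → Submodule K U) : Prop :=
  DirectSum.IsInternal W ∧
    ∀ (x : Fin n → U) (k l : Fin n) (i j : ι), i ≠ j → x k ∈ W i → x l ∈ W j → F x = 0

/-- A multilinear form is indecomposable if in every direct-sum decomposition one of the
two subspaces is zero. -/
def FormIndecomposable {U : Type*} [AddCommGroup U] [Module K U]
    (F : MultilinearMap K (fun _ : Fin n => U) K) : Prop :=
  ∀ W₁ W₂ : Submodule K U, IsCompl W₁ W₂ →
    (∀ (x : Fin n → U) (k l : Fin n), x k ∈ W₁ → x l ∈ W₂ → F x = 0) →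
    W₁ = ⊥ ∨ W₂ = ⊥

/-- A multilinear form has no zero direct summands if in every direct-sum decomposition the
summand that is the zero form corresponds to the zero subspace. -/
def FormNoZeroSummand {U : Type*} [AddCommGroup U] [Module K U]
    (F : MultilinearMap K (fun _ : Fin n => U) K) : Prop :=
  ∀ W₁ W₂ : Submodule K U, IsCompl W₁ W₂ →
    (∀ (x : Fin n → U) (k l : Fin n), x k ∈ W₁ → x l ∈ W₂ → F x = 0) →
    (∀ x : Fin n → U, (∀ k, x k ∈ W₂) → F x = 0) → W₂ = ⊥

/-- A linear map `τ` is `G`-selfadjoint if applying `τ` in any one argument of `G`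
gives the same value regardless of the argument chosen. -/
def FormSelfAdjoint {V : Type*} [AddCommGroup V] [Module K V]
    (G : MultilinearMap K (fun _ : Fin n => V) K) (τ : V →ₗ[K] V) : Prop :=
  ∀ (v : Fin n → V) (i j : Fin n),
    G (Function.update v i (τ (v i))) = G (Function.update v j (τ (v j)))

end Defs

open Polynomial in
/-- Over `ℂ`, `X` has a `k`-th root modulo any product of factors `X - a` with `a ≠ 0`. -/
theorem exists_prod_X_sub_C_dvd_pow_sub_X {k : ℕ} (hk : k ≠ 0) (s : Multiset ℂ)
    (hs : ∀ a ∈ s, a ≠ 0) :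
    ∃ p : ℂ[X], (s.map fun a => X - C a).prod ∣ p ^ k - X := by
  induction s using Multiset.induction_on with
  | empty => exact ⟨0, by simp⟩
  | cons a s ih =>
    obtain ⟨p, hp⟩ := ih fun b hb => hs b (Multiset.mem_cons_of_mem hb)
    have ha : a ≠ 0 := hs a (Multiset.mem_cons_self a s)
    rw [Multiset.map_cons, Multiset.prod_cons]
    generalize (s.map fun a => X - C a).prod = g at hp ⊢
    by_cases hg : g.eval a = 0
    · obtain ⟨h, hh⟩ := hp
      have hpa : p.eval a ^ k = a := by
        have := congrArg (eval a) hh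
        simp only [eval_sub, eval_pow, eval_X, eval_mul, hg, zero_mul] at this
        exact sub_eq_zero.mp this
      have hp0 : p.eval a ≠ 0 := by
        intro h0
        rw [h0, zero_pow hk] at hpa
        exact ha hpa.symm
      have hd : (k : ℂ) * p.eval a ^ (k - 1) ≠ 0 :=
        mul_ne_zero (Nat.cast_ne_zero.mpr hk) (pow_ne_zero _ hp0)
      let c : ℂ := -h.eval a / ((k : ℂ) * p.eval a ^ (k - 1))
      obtain ⟨r, hr⟩ := powAddExpansion p (C c * g) k
      refine ⟨p + C c * g, ?_⟩
      have key : (p + C c * g) ^ k - X =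
          (h + (k : ℂ[X]) * p ^ (k - 1) * C c + r * C c ^ 2 * g) * g := by
        rw [hr]
        linear_combination hh
      rw [key]
      refine mul_dvd_mul_right (dvd_iff_isRoot.mpr ?_) g
      simp only [IsRoot, eval_add, eval_mul, eval_pow, eval_C, eval_natCast, hg, mul_zero,
        add_zero, c]
      rw [mul_div_cancel₀ _ hd, add_neg_cancel]
    · obtain ⟨z, hz⟩ := IsAlgClosed.exists_pow_nat_eq a (Nat.pos_of_ne_zero hk)
      refine ⟨p + C ((z - p.eval a) / g.eval a) * g, ?_⟩
      refine IsCoprime.mul_dvd ?_ (dvd_iff_isRoot.mpr ?_) ?_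
      · exact (irreducible_X_sub_C a).coprime_iff_not_dvd.mpr fun h => hg (dvd_iff_isRoot.mp h)
      · simp only [IsRoot, eval_sub, eval_add, eval_mul, eval_pow, eval_C, eval_X]
        rw [div_mul_cancel₀ _ hg, add_sub_cancel, hz, sub_self]
      · have h1 : g ∣ (p + C ((z - p.eval a) / g.eval a) * g) ^ k - p ^ k :=
          dvd_trans (by simp) (sub_dvd_pow_sub_pow _ _ k)
        simpa using dvd_add h1 hp

open Polynomial in
/-- An invertible complex operator has a `k`-th root that is a polynomial in the operator. -/
theorem exists_aeval_pow_eq_of_isUnit {V : Type*} [AddCommGroup V] [Module ℂ V]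
    [FiniteDimensional ℂ V] {τ : Module.End ℂ V} (hτ : IsUnit τ) {k : ℕ} (hk : k ≠ 0) :
    ∃ p : ℂ[X], aeval τ p ^ k = τ := by
  obtain ⟨p, hp⟩ := exists_prod_X_sub_C_dvd_pow_sub_X hk (minpoly ℂ τ).roots (by
    rintro a ha rfl
    have h0 : τ.HasEigenvalue 0 := Module.End.hasEigenvalue_of_isRoot (isRoot_of_mem_roots ha)
    obtain ⟨v, hv⟩ := h0.exists_hasEigenvector
    have hinj := ((Module.End.isUnit_iff τ).mp hτ).injective
    exact hv.2 (hinj (by simpa using hv.apply_eq_smul)))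
  rw [← (IsAlgClosed.splits (minpoly ℂ τ)).eq_prod_roots_of_monic
    (minpoly.monic (Algebra.IsIntegral.isIntegral τ))] at hp
  refine ⟨p, ?_⟩
  have := (minpoly.dvd_iff).mp hp
  rw [map_sub, map_pow, aeval_X] at this
  exact sub_eq_zero.mp this

namespace FormSelfAdjoint

variable {K V : Type*} [Field K] [AddCommGroup V] [Module K V] {n : ℕ}
  {G : MultilinearMap K (fun _ : Fin n => V) K}

theorem algebraMap (c : K) : FormSelfAdjoint G (algebraMap K (Module.End K V) c) := by
  intro v i j
  simp [Module.algebraMap_end_apply]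

theorem add {a b : Module.End K V} (ha : FormSelfAdjoint G a) (hb : FormSelfAdjoint G b) :
    FormSelfAdjoint G (a + b) := by
  intro v i j
  simp only [LinearMap.add_apply, MultilinearMap.map_update_add, ha v i j, hb v i j]

theorem mul {a b : Module.End K V} (ha : FormSelfAdjoint G a) (hb : FormSelfAdjoint G b)
    (hab : Commute a b) : FormSelfAdjoint G (a * b) := by
  intro v i j
  obtain rfl | hij := eq_or_ne i j
  · rfl
  have h1 := ha (Function.update v i (b (v i))) i j
  have h2 := hb (Function.update v j (a (v j))) i j
  simp only [Function.update_idem, Function.update_self, Function.update_of_ne hij,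
    Function.update_of_ne hij.symm] at h1 h2
  rw [Function.update_comm hij] at h1
  calc _ = _ := h1
    _ = _ := h2
    _ = _ := by rw [hab.eq]; rfl

theorem pow {a : Module.End K V} (ha : FormSelfAdjoint G a) (m : ℕ) :
    FormSelfAdjoint G (a ^ m) := by
  induction m with
  | zero => simpa using FormSelfAdjoint.algebraMap (G := G) (1 : K)
  | succ m ih => exact pow_succ a m ▸ ih.mul ha (Commute.pow_self a m)

theorem aeval {a : Module.End K V} (ha : FormSelfAdjoint G a) (p : Polynomial K) :
    FormSelfAdjoint G (Polynomial.aeval a p) := by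
  induction p using Polynomial.induction_on' with
  | add p q hp hq => exact map_add (Polynomial.aeval a) p q ▸ hp.add hq
  | monomial m c =>
    rw [Polynomial.aeval_monomial]
    exact (FormSelfAdjoint.algebraMap c).mul (ha.pow m) (Algebra.commutes c _)

/-- Copies of a selfadjoint operator in different arguments can be gathered in one argument. -/
theorem apply_ite_mem {a : Module.End K V} (ha : FormSelfAdjoint G a) (s : Finset (Fin n))
    (i : Fin n) (v : Fin n → V) :
    G (fun k => if k ∈ s then a (v k) else v k) =
      G (Function.update v i ((a ^ s.card) (v i))) := by
  induction s using Finset.induction_on generalizing v with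
  | empty => simp
  | insert j s hj ih =>
    have h1 : (fun k => if k ∈ insert j s then a (v k) else v k) = fun k =>
        if k ∈ s then a (Function.update v j (a (v j)) k)
        else Function.update v j (a (v j)) k := by
      ext k
      obtain rfl | hk := eq_or_ne k j
      · simp [hj]
      · simp [hk]
    rw [h1, ih, Finset.card_insert_of_notMem hj]
    obtain rfl | hij := eq_or_ne i j
    · simp [pow_succ]
    · have h2 := ha (Function.update v i ((a ^ s.card) (v i))) j i
      simp only [Function.update_idem, Function.update_self,
        Function.update_of_ne hij.symm] at h2
      rw [Function.update_of_ne hij, Function.update_comm hij.symm, h2, pow_succ']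
      rfl

/-- Symmetric equivalence makes the quotient of two of its bijections selfadjoint. -/
theorem of_symmEquiv {U : Type*} [AddCommGroup U] [Module K U]
    {F : MultilinearMap K (fun _ : Fin n => U) K} {φ : Fin n → U ≃ₗ[K] V}
    (hsym : ∀ (σ : Equiv.Perm (Fin n)) (u : Fin n → U), F u = G fun i => φ (σ i) (u i))
    {p q : Fin n} (hpq : p ≠ q) :
    FormSelfAdjoint G ((φ p).symm.trans (φ q)).toLinearMap := by
  intro v i j
  obtain rfl | hij := eq_or_ne i j
  · rfl
  obtain ⟨σ, hi, hj⟩ : ∃ σ : Equiv.Perm (Fin n), σ i = p ∧ σ j = q := by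
    have hne : Equiv.swap i p j ≠ p := fun h =>
      hij.symm ((Equiv.swap i p).injective (h.trans (Equiv.swap_apply_left i p).symm))
    exact ⟨Equiv.swap (Equiv.swap i p j) q * Equiv.swap i p,
      by simp [Equiv.swap_apply_of_ne_of_ne hne.symm hpq], by simp⟩
  let u : Fin n → U := fun k => if k = j then (φ p).symm (v j) else (φ (σ k)).symm (v k)
  have h1 := hsym σ u
  rw [hsym (σ * Equiv.swap i j) u] at h1
  convert h1 using 2
  · ext k
    obtain rfl | hki := eq_or_ne k i
    · simp [u, hij, hi, hj]
    · obtain rfl | hkj := eq_or_ne k j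
      · simp [u, hki, hi]
      · simp [u, hki, hkj, Equiv.swap_apply_of_ne_of_ne hki hkj]
  · ext k
    obtain rfl | hkj := eq_or_ne k j
    · simp [u, hj]
    · simp [u, hkj]

end FormSelfAdjoint

/-- Induction step of Theorem (a): if complex forms `F`, `G` are symmetrically equivalent via
`φ₁, …, φₙ` (indexed here by `Fin n`, zero-based) with `φ₁ = ⋯ = φ_t` for some `t < n`, then
they are symmetrically equivalent via bijections `ψ₁, …, ψₙ` with `ψ₁ = ⋯ = ψ_t = ψ_{t+1}`. -/
theorem stmt_8 {n : ℕ} (hn : 2 ≤ n) {U V : Type*}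
    [AddCommGroup U] [Module ℂ U] [FiniteDimensional ℂ U]
    [AddCommGroup V] [Module ℂ V] [FiniteDimensional ℂ V]
    (F : MultilinearMap ℂ (fun _ : Fin n => U) ℂ)
    (G : MultilinearMap ℂ (fun _ : Fin n => V) ℂ)
    (φ : Fin n → U ≃ₗ[ℂ] V)
    (hsym : ∀ (σ : Equiv.Perm (Fin n)) (u : Fin n → U),
      F u = G fun i => φ (σ i) (u i))
    (t : ℕ) (h0 : 0 < t) (ht : t < n)
    (hconst : ∀ i : Fin n, (i : ℕ) < t → φ i = φ ⟨0, h0.trans ht⟩) :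
    ∃ ψ : Fin n → U ≃ₗ[ℂ] V,
      (∀ i : Fin n, (i : ℕ) ≤ t → ψ i = ψ ⟨0, h0.trans ht⟩) ∧
      ∀ (σ : Equiv.Perm (Fin n)) (u : Fin n → U),
        F u = G fun i => ψ (σ i) (u i) := by
  let z : Fin n := ⟨0, h0.trans ht⟩
  let q : Fin n := ⟨t, ht⟩
  have hzq : z ≠ q := fun h => h0.ne (congrArg Fin.val h)
  let e : V ≃ₗ[ℂ] V := (φ z).symm.trans (φ q)
  let τ : Module.End ℂ V := e.toLinearMap
  have hτ : IsUnit τ := (Module.End.isUnit_iff τ).mpr e.bijective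
  obtain ⟨p, hp⟩ := exists_aeval_pow_eq_of_isUnit hτ t.succ_ne_zero
  have hρ : FormSelfAdjoint G (Polynomial.aeval τ p) :=
    (FormSelfAdjoint.of_symmEquiv hsym hzq).aeval p
  generalize Polynomial.aeval τ p = ρ at hp hρ
  have hρu : IsUnit ρ := (isUnit_pow_iff t.succ_ne_zero).mp (hp.symm ▸ hτ)
  let r : V ≃ₗ[ℂ] V := LinearEquiv.ofBijective ρ ((Module.End.isUnit_iff ρ).mp hρu)
  refine ⟨fun i => if (i : ℕ) ≤ t then (φ z).trans r else φ i,
    fun i hi => by simp [hi], fun σ u => ?_⟩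
  let v : Fin n → V := fun k => if (σ k : ℕ) ≤ t then φ z (u k) else φ (σ k) (u k)
  let s : Finset (Fin n) := (Finset.Iic q).map σ.symm.toEmbedding
  have hmem (k : Fin n) : k ∈ s ↔ (σ k : ℕ) ≤ t := by
    simp [s, q, Fin.le_def]
  have hcard : s.card = t + 1 := by simp [s, q]
  have h := hρ.apply_ite_mem s (σ.symm q) v
  rw [hcard, hp] at h
  rw [hsym σ u]
  refine Eq.trans ?_ (h.symm.trans ?_)
  · congr 1
    ext k
    obtain rfl | hk := eq_or_ne k (σ.symm q)
    · simp [v, τ, e, q]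
    · have hkq : (σ k : ℕ) ≠ t := fun h => hk (by
        rw [Equiv.eq_symm_apply]; exact Fin.ext h)
      rw [Function.update_of_ne hk]
      by_cases hkt : (σ k : ℕ) ≤ t
      · simp only [v, if_pos hkt]
        rw [hconst (σ k) (lt_of_le_of_ne hkt hkq)]
      · simp only [v, if_neg hkt]
  · congr 1
    ext k
    by_cases hkt : (σ k : ℕ) ≤ t
    · simp [hmem, v, hkt, r]
    · simp [hmem, v, hkt]
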